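/- Let Δ ⊂ ℝ² be a lattice with covering radius ρ(Δ) < π/2, let p ∈ Δ, and let H_p = { q ∈ ℝ² : ‖q − p‖ ≤ ‖q − p′‖ for all p′ ∈ Δ } be the closed Voronoi cell of p. Let γ = (γ₁,γ₂,γ₃) : [0,1] → ℝ³ be a piecewise C¹ curve with (γ₁(t),γ₂(t)) ∈ H_p for all t, and set r(t) = ‖(γ₁(t),γ₂(t)) − p‖ (a Lipschitz function, differentiable almost everywhere). Then L_Δ(γ) ≥ ∫₀¹ √( r′(t)² + cos²(r(t)) · γ₃′(t)² ) dt. (In particular, the surfaces θ = constant through the vertical axis over p are totally geodesic inside the prism over H_p.) -/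

import Mathlib

open Real MeasureTheory Set

noncomputable section

/-- The point `(x, y)` of the Euclidean plane. -/
def pt2 (x y : ℝ) : EuclideanSpace ℝ (Fin 2) := (WithLp.equiv 2 (Fin 2 → ℝ)).symm ![x, y]

/-- `f : [0,1] → ℝ` is piecewise `C¹`. -/
def PC1 (f : ℝ → ℝ) : Prop :=
  ∃ (n : ℕ) (t : ℕ → ℝ), t 0 = 0 ∧ t n = 1 ∧ (∀ i < n, t i < t (i + 1)) ∧
    ContinuousOn f (Set.Icc 0 1) ∧ ∀ i < n, ContDiffOn ℝ 1 f (Set.Icc (t i) (t (i + 1)))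

/-- Length of `γ = (γ₁,γ₂,γ₃)` for the singular metric
`h = dx² + dy² + cos²(dist((x,y),Δ)) dz²`. -/
def sLen (Δ : Set (EuclideanSpace ℝ (Fin 2))) (γ₁ γ₂ γ₃ : ℝ → ℝ) : ℝ :=
  ∫ t in (0:ℝ)..1, Real.sqrt ((deriv γ₁ t) ^ 2 + (deriv γ₂ t) ^ 2 +
    Real.cos (Metric.infDist (pt2 (γ₁ t) (γ₂ t)) Δ) ^ 2 * (deriv γ₃ t) ^ 2)

/-- The covering radius `ρ(Δ) = sup_{p ∈ ℝ²} dist(p, Δ)` of `Δ ⊂ ℝ²`. -/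
def covRad (Δ : Set (EuclideanSpace ℝ (Fin 2))) : ℝ :=
  ⨆ p : EuclideanSpace ℝ (Fin 2), Metric.infDist p Δ

/-- A piecewise `C¹` function is, off a finite set, differentiable with bounded derivative. -/
lemma PC1.exists_bound_deriv {f : ℝ → ℝ} (hf : PC1 f) :
    ∃ (C : ℝ) (S : Set ℝ), S.Finite ∧ ∀ x ∈ Icc (0:ℝ) 1, x ∉ S →
      DifferentiableAt ℝ f x ∧ |deriv f x| ≤ C := by
  obtain ⟨n, t, h0, h1, hlt, -, hC⟩ := hf
  have bound : ∀ k ≤ n, ∃ C : ℝ, ∀ x ∈ Icc (t 0) (t k), x ∉ t '' Iic n →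
      DifferentiableAt ℝ f x ∧ |deriv f x| ≤ C := by
    intro k
    induction k with
    | zero =>
      refine fun _ => ⟨0, fun x hx hxS => absurd ?_ hxS⟩
      exact ⟨0, Nat.zero_le n, le_antisymm hx.1 hx.2⟩
    | succ k ih =>
      intro hk
      obtain ⟨C, hC'⟩ := ih (by omega)
      have hu := uniqueDiffOn_Icc (hlt k hk)
      obtain ⟨D, hD⟩ := isCompact_Icc.exists_bound_of_continuousOn
        ((hC k hk).continuousOn_derivWithin hu le_rfl)
      refine ⟨max C D, fun x hx hxS => ?_⟩
      rcases le_or_gt x (t k) with hle | hgt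
      · have := hC' x ⟨hx.1, hle⟩ hxS
        exact ⟨this.1, this.2.trans (le_max_left _ _)⟩
      · have hne : x ≠ t (k + 1) := fun h => hxS ⟨k + 1, hk, h.symm⟩
        have hxI : Icc (t k) (t (k + 1)) ∈ nhds x :=
          Icc_mem_nhds hgt (lt_of_le_of_ne hx.2 hne)
        have hb := hD x ⟨hgt.le, hx.2⟩
        rw [derivWithin_of_mem_nhds hxI, Real.norm_eq_abs] at hb
        exact ⟨((hC k hk).differentiableOn one_ne_zero).differentiableAt hxI,
          hb.trans (le_max_right _ _)⟩
  obtain ⟨C, hC'⟩ := bound n le_rfl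
  rw [h0, h1] at hC'
  exact ⟨C, _, (finite_Iic n).image t, hC'⟩

lemma PC1.continuousOn {f : ℝ → ℝ} (hf : PC1 f) : ContinuousOn f (Icc 0 1) := by
  obtain ⟨-, -, -, -, -, hc, -⟩ := hf
  exact hc

/-- Off a finite set, hence almost everywhere on `[0,1]`, a piecewise `C¹` function is
differentiable with bounded derivative. -/
lemma PC1.ae_bound_deriv {f : ℝ → ℝ} (hf : PC1 f) :
    ∃ C : ℝ, ∀ᵐ x ∂(volume.restrict (Ioc (0:ℝ) 1)), DifferentiableAt ℝ f x ∧ |deriv f x| ≤ C := by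
  obtain ⟨C, S, hS, h⟩ := hf.exists_bound_deriv
  refine ⟨C, ?_⟩
  filter_upwards [ae_restrict_mem measurableSet_Ioc,
    ae_restrict_of_ae (measure_eq_zero_iff_ae_notMem.mp (hS.measure_zero volume))] with x hx hxS
  exact h x (Ioc_subset_Icc_self hx) hxS

lemma continuous_pt2 : Continuous fun z : ℝ × ℝ => pt2 z.1 z.2 := by
  refine (PiLp.continuous_toLp 2 _).comp (continuous_pi fun i => ?_)
  fin_cases i
  · exact continuous_fst
  · exact continuous_snd

lemma dist_pt2 (x y : ℝ) (p : EuclideanSpace ℝ (Fin 2)) :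
    dist (pt2 x y) p = √((x - p 0) ^ 2 + (y - p 1) ^ 2) := by
  simp [EuclideanSpace.dist_eq, pt2, Real.dist_eq, sq_abs]

/-- The distance of a moving point to a fixed one varies at most as fast as the point moves. -/
lemma sq_deriv_dist_pt2_le {f g : ℝ → ℝ} {t : ℝ} (hf : DifferentiableAt ℝ f t)
    (hg : DifferentiableAt ℝ g t) (p : EuclideanSpace ℝ (Fin 2)) :
    (deriv (fun s => dist (pt2 (f s) (g s)) p) t) ^ 2 ≤ (deriv f t) ^ 2 + (deriv g t) ^ 2 := by
  by_cases h0 : (f t - p 0) ^ 2 + (g t - p 1) ^ 2 = 0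
  · have hmin : IsLocalMin (fun s => dist (pt2 (f s) (g s)) p) t :=
      Filter.Eventually.of_forall fun s => by
        simp only [dist_pt2 (f t), h0, Real.sqrt_zero]
        exact dist_nonneg
    rw [hmin.deriv_eq_zero, zero_pow two_ne_zero]
    positivity
  · have hd := ((((hf.hasDerivAt.sub_const (p 0)).fun_pow 2).fun_add
      ((hg.hasDerivAt.sub_const (p 1)).fun_pow 2)).sqrt h0).deriv
    simp only [dist_pt2]
    rw [hd, div_pow, mul_pow, Real.sq_sqrt (by positivity), div_le_iff₀ (by positivity)]
    push_cast
    nlinarith [sq_nonneg ((f t - p 0) * deriv g t - (g t - p 1) * deriv f t)]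

lemma PC1.integrable_sLen {f g h : ℝ → ℝ} (hf : PC1 f) (hg : PC1 g) (hh : PC1 h)
    (Δ : Set (EuclideanSpace ℝ (Fin 2))) :
    Integrable (fun t => √((deriv f t) ^ 2 + (deriv g t) ^ 2 +
      Real.cos (Metric.infDist (pt2 (f t) (g t)) Δ) ^ 2 * (deriv h t) ^ 2))
      (volume.restrict (Ioc (0:ℝ) 1)) := by
  obtain ⟨A, hA⟩ := hf.ae_bound_deriv
  obtain ⟨B, hB⟩ := hg.ae_bound_deriv
  obtain ⟨C, hC⟩ := hh.ae_bound_deriv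
  refine Integrable.of_bound (C := √(A ^ 2 + B ^ 2 + C ^ 2)) ?_ ?_
  · have hcos : ContinuousOn
        (fun t => Real.cos (Metric.infDist (pt2 (f t) (g t)) Δ)) (Ioc 0 1) :=
      ((Real.continuous_cos.comp ((Metric.continuous_infDist_pt Δ).comp
        continuous_pt2)).comp_continuousOn (hf.continuousOn.prodMk hg.continuousOn)).mono
        Ioc_subset_Icc_self
    have hm := (hcos.aestronglyMeasurable (μ := volume) measurableSet_Ioc).aemeasurable
    refine AEMeasurable.aestronglyMeasurable ?_
    have h₁ := (measurable_deriv f).aemeasurable (μ := volume.restrict (Ioc (0:ℝ) 1))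
    have h₂ := (measurable_deriv g).aemeasurable (μ := volume.restrict (Ioc (0:ℝ) 1))
    have h₃ := (measurable_deriv h).aemeasurable (μ := volume.restrict (Ioc (0:ℝ) 1))
    exact (((h₁.pow_const 2).add (h₂.pow_const 2)).add
      ((hm.pow_const 2).mul (h₃.pow_const 2))).sqrt
  · filter_upwards [hA, hB, hC] with t hA hB hC
    rw [Real.norm_of_nonneg (Real.sqrt_nonneg _)]
    refine Real.sqrt_le_sqrt (add_le_add (add_le_add ?_ ?_) ?_)
    · exact sq_le_sq' (abs_le.mp hA.2).1 (abs_le.mp hA.2).2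
    · exact sq_le_sq' (abs_le.mp hB.2).1 (abs_le.mp hB.2).2
    · exact (mul_le_of_le_one_left (sq_nonneg _) (Real.cos_sq_le_one _)).trans
        (sq_le_sq' (abs_le.mp hC.2).1 (abs_le.mp hC.2).2)

lemma infDist_eq_dist_of_forall_le {X : Type*} [PseudoMetricSpace X] {s : Set X} {x p : X}
    (hp : p ∈ s) (h : ∀ q ∈ s, dist x p ≤ dist x q) : Metric.infDist x s = dist x p :=
  le_antisymm (Metric.infDist_le_dist_of_mem hp)
    ((Metric.le_infDist ⟨p, hp⟩).mpr fun _ hq => h _ hq)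

/-- let `Δ ⊂ ℝ²` be a lattice with covering radius `ρ(Δ) < π/2`, `p ∈ Δ`, and
let the horizontal projection of the piecewise `C¹` curve `γ` stay in the closed Voronoi cell
`H_p = {q : ∀ p' ∈ Δ, ‖q − p‖ ≤ ‖q − p'‖}`.  With `r(t) = ‖(γ₁(t),γ₂(t)) − p‖`, we have
`L_Δ(γ) ≥ ∫₀¹ √(r′(t)² + cos²(r(t))·γ₃′(t)²) dt`: the surfaces `θ = const` over `p` are
totally geodesic inside the prism over `H_p`. -/
theorem singular_length_ge_profile_length
    (u v : EuclideanSpace ℝ (Fin 2)) (huv : LinearIndependent ℝ ![u, v])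
    (Δ : Set (EuclideanSpace ℝ (Fin 2)))
    (hΔ : Δ = {q | ∃ m n : ℤ, q = (m : ℝ) • u + (n : ℝ) • v})
    (hρ : covRad Δ < π / 2)
    (p : EuclideanSpace ℝ (Fin 2)) (hp : p ∈ Δ)
    (γ₁ γ₂ γ₃ : ℝ → ℝ) (h₁ : PC1 γ₁) (h₂ : PC1 γ₂) (h₃ : PC1 γ₃)
    (hH : ∀ t ∈ Set.Icc (0:ℝ) 1, ∀ p' ∈ Δ,
      dist (pt2 (γ₁ t) (γ₂ t)) p ≤ dist (pt2 (γ₁ t) (γ₂ t)) p') :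
    (∫ t in (0:ℝ)..1,
        Real.sqrt ((deriv (fun s => dist (pt2 (γ₁ s) (γ₂ s)) p) t) ^ 2 +
          Real.cos (dist (pt2 (γ₁ t) (γ₂ t)) p) ^ 2 * (deriv γ₃ t) ^ 2)) ≤
      sLen Δ γ₁ γ₂ γ₃ := by
  obtain ⟨_, hA⟩ := h₁.ae_bound_deriv
  obtain ⟨_, hB⟩ := h₂.ae_bound_deriv
  rw [sLen, intervalIntegral.integral_of_le zero_le_one,
    intervalIntegral.integral_of_le zero_le_one]
  refine integral_mono_of_nonneg (Filter.Eventually.of_forall fun t => Real.sqrt_nonneg _)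
    (h₁.integrable_sLen h₂ h₃ Δ) ?_
  filter_upwards [hA, hB, ae_restrict_mem measurableSet_Ioc] with t hA hB ht
  rw [infDist_eq_dist_of_forall_le hp (hH t (Ioc_subset_Icc_self ht))]
  gcongr
  exact sq_deriv_dist_pt2_le hA.1 hB.1 p

end
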